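/- Let (R, 𝔪) be a commutative Noetherian local ring and M a generalized Cohen-Macaulay R-module of dimension d > 0. Let n₀ be the least positive integer such that 𝔪^{n₀}·H^i_𝔪(M) = 0 for all i < d. Then for every parameter element x of M with x ∈ 𝔪^{2n₀}, there are isomorphisms H^i_𝔪(M/xM) ≅ H^i_𝔪(M) ⊕ H^{i+1}_𝔪(M) for all i < d−1. -/

import Mathlib

open CategoryTheory IsLocalRing

namespace LCSplit
open Limits Opposite


section cpx
variable {R : Type} [CommRing R]

/-- `f` is a cocycle representing the class `c`. -/
def RepK (K : ChainComplex (ModuleCat.{0} R)ᵒᵖ ℕ) (i : ℕ)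
    (f : (K.X i).unop) (c : (K.homology i).unop) : Prop :=
  ∃ z : (K.opcycles i).unop, (K.pOpcycles i).unop z = f ∧ (K.homologyι i).unop z = c

variable {K L : ChainComplex (ModuleCat.{0} R)ᵒᵖ ℕ} {i : ℕ}

lemma RepK.add {f f' : (K.X i).unop} {c c' : (K.homology i).unop}
    (h : RepK K i f c) (h' : RepK K i f' c') : RepK K i (f + f') (c + c') := by
  obtain ⟨z, rfl, rfl⟩ := h
  obtain ⟨z', rfl, rfl⟩ := h'
  exact ⟨z + z', by simp, by simp⟩

lemma RepK.smul (r : R) {f : (K.X i).unop} {c : (K.homology i).unop}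
    (h : RepK K i f c) : RepK K i (r • f) (r • c) := by
  obtain ⟨z, rfl, rfl⟩ := h
  exact ⟨r • z, by simp, by simp⟩

lemma RepK.cocycle {f : (K.X i).unop} {c : (K.homology i).unop}
    (h : RepK K i f c) : (K.d (i+1) i).unop f = 0 := by
  obtain ⟨z, rfl, rfl⟩ := h
  have := congrArg Quiver.Hom.unop (K.d_pOpcycles (i+1) i)
  rw [unop_comp] at this
  exact congrArg (fun g => g.hom z) this

lemma pOp_inj {z z' : (K.opcycles i).unop}
    (h : (K.pOpcycles i).unop z = (K.pOpcycles i).unop z') : z = z' := by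
  have : Mono (K.pOpcycles i).unop := inferInstance
  exact (ModuleCat.mono_iff_injective _).1 this h

lemma RepK.exists_of_cocycle (f : (K.X i).unop) (h : (K.d (i+1) i).unop f = 0) :
    ∃ c, RepK K i f c := by
  let k : ModuleCat.of R R ⟶ (K.X i).unop := ModuleCat.ofHom (LinearMap.toSpanSingleton R _ f)
  have hk : K.d (i+1) i ≫ k.op = 0 := by
    apply Quiver.Hom.unop_inj
    rw [unop_comp]
    ext
    simpa [k] using h
  let q := K.descOpcycles k.op (i+1) (by simp) hk
  have hq : q.unop ≫ (K.pOpcycles i).unop = k := by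
    rw [← unop_comp, K.p_descOpcycles]; rfl
  refine ⟨_, q.unop (1 : R), ?_, rfl⟩
  have := congrArg (fun g => g.hom (1 : R)) hq
  simpa [k] using this

lemma RepK.surj (c : (K.homology i).unop) : ∃ f, RepK K i f c := by
  have : Epi (K.homologyι i).unop := inferInstance
  obtain ⟨z, hz⟩ := (ModuleCat.epi_iff_surjective _).1 this c
  exact ⟨_, z, rfl, hz⟩

lemma RepK.zero_iff (f : (K.X i).unop) : RepK K i f 0 ↔
    ∃ g : (K.X (i-1)).unop, (K.d i (i-1)).unop g = f := by
  constructor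
  · rintro ⟨z, rfl, hz⟩
    have hex := (ShortComplex.exact_of_f_is_kernel
      (ShortComplex.mk _ _ (K.homologyι_comp_fromOpcycles i (i-1)))
      (K.homologyIsKernel i (i-1) (by cases i <;> simp))).unop
    rw [ShortComplex.moduleCat_exact_iff] at hex
    obtain ⟨g, hg⟩ := hex z hz
    refine ⟨g, ?_⟩
    rw [← hg]
    have := congrArg Quiver.Hom.unop (K.p_fromOpcycles i (i-1))
    rw [unop_comp] at this
    exact (congrArg (fun q => q.hom g) this).symm
  · rintro ⟨g, rfl⟩
    refine ⟨(K.fromOpcycles i (i-1)).unop g, ?_, ?_⟩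
    · have := congrArg Quiver.Hom.unop (K.p_fromOpcycles i (i-1))
      rw [unop_comp] at this
      exact (congrArg (fun q => q.hom g) this)
    · have := congrArg Quiver.Hom.unop (K.homologyι_comp_fromOpcycles i (i-1))
      rw [unop_comp] at this
      exact (congrArg (fun q => q.hom g) this)

lemma RepK.map (φ : K ⟶ L) {f : (L.X i).unop} {c : (L.homology i).unop}
    (h : RepK L i f c) : RepK K i ((φ.f i).unop f)
      ((HomologicalComplex.homologyMap φ i).unop c) := by
  obtain ⟨z, rfl, rfl⟩ := h
  refine ⟨(HomologicalComplex.opcyclesMap φ i).unop z, ?_, ?_⟩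
  · have := congrArg Quiver.Hom.unop (HomologicalComplex.p_opcyclesMap φ i)
    rw [unop_comp, unop_comp] at this
    exact (congrArg (fun q => q.hom z) this)
  · have := congrArg Quiver.Hom.unop (HomologicalComplex.homologyι_naturality φ i)
    rw [unop_comp, unop_comp] at this
    exact (congrArg (fun q => q.hom z) this).symm

end cpx

section loc
variable {R : Type} [CommRing R] (I : Ideal R)

/-- The local cohomology module. -/
noncomputable abbrev T (i : ℕ) (M : ModuleCat.{0} R) : ModuleCat.{0} R := (localCohomology I i).obj M

/-- The quotient `R / I ^ n`. -/
abbrev Xq (n : ℕ) : ModuleCat.{0} R :=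
  (localCohomology.ringModIdeals (localCohomology.idealPowersDiagram I)).obj (op n)

/-- The projection `R / I ^ m → R / I ^ n`. -/
abbrev Xtr {n m : ℕ} (h : n ≤ m) : Xq I m ⟶ Xq I n :=
  (localCohomology.ringModIdeals (localCohomology.idealPowersDiagram I)).map (homOfLE h).op

/-- A projective resolution. -/
noncomputable def Pr (n : ℕ) : ProjectiveResolution (Xq I n) := projectiveResolution _

/-- The chosen lift. -/
noncomputable def phi {n m : ℕ} (h : n ≤ m) : (Pr I m).complex ⟶ (Pr I n).complex :=
  ProjectiveResolution.lift (Xtr I h) (Pr I m) (Pr I n)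

lemma phi_comm {n m : ℕ} (h : n ≤ m) :
    (phi I h).f 0 ≫ (Pr I n).π.f 0 = (Pr I m).π.f 0 ≫ Xtr I h :=
  ProjectiveResolution.lift_commutes_zero _ _ _

/-- The complex computing `Ext`. -/
noncomputable abbrev Kc (M : ModuleCat.{0} R) (n : ℕ) : ChainComplex (ModuleCat.{0} R)ᵒᵖ ℕ :=
  (((linearYoneda R (ModuleCat.{0} R)).obj M).rightOp.mapHomologicalComplex _).obj (Pr I n).complex

/-- The `Ext` module. -/
noncomputable abbrev Em (i : ℕ) (M : ModuleCat.{0} R) (n : ℕ) : ModuleCat.{0} R :=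
  ((localCohomology.diagram (localCohomology.idealPowersDiagram I) i).obj (op (op n))).obj M

/-- from homology to `Ext`. -/
noncomputable def toE (i : ℕ) (M : ModuleCat.{0} R) (n : ℕ) :
    ((Kc I M n).homology i).unop ≅ Em I i M n :=
  ((Pr I n).isoLeftDerivedObj ((linearYoneda R (ModuleCat.{0} R)).obj M).rightOp i).unop

/-- from `Ext` to local cohomology. -/
noncomputable def toT (i : ℕ) (M : ModuleCat.{0} R) (n : ℕ) : Em I i M n ⟶ T I i M :=
  (colimit.ι (localCohomology.diagram (localCohomology.idealPowersDiagram I) i) (op (op n))).app M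

variable {I}

/-- `f` is a cocycle at level `n` representing the local cohomology class `c`. -/
def Rep {i : ℕ} {M : ModuleCat.{0} R} (n : ℕ) (f : (Pr I n).complex.X i ⟶ M) (c : T I i M) : Prop :=
  ∃ e : ((Kc I M n).homology i).unop, RepK (Kc I M n) i f e ∧ toT I i M n ((toE I i M n).hom e) = c

variable {i : ℕ} {M N : ModuleCat.{0} R} {n m : ℕ}

lemma Rep.add {f f' : (Pr I n).complex.X i ⟶ M} {c c' : T I i M} (h : Rep n f c)
    (h' : Rep n f' c') : Rep n (f + f') (c + c') := by
  obtain ⟨e, he, rfl⟩ := h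
  obtain ⟨e', he', rfl⟩ := h'
  exact ⟨e + e', he.add he', by simp⟩

lemma Rep.smul (r : R) {f : (Pr I n).complex.X i ⟶ M} {c : T I i M} (h : Rep n f c) :
    Rep n (r • f) (r • c) := by
  obtain ⟨e, he, rfl⟩ := h
  exact ⟨r • e, he.smul r, by simp⟩

lemma Rep.sub {f f' : (Pr I n).complex.X i ⟶ M} {c c' : T I i M} (h : Rep n f c)
    (h' : Rep n f' c') : Rep n (f - f') (c - c') := by
  have := h.add (h'.smul (-1))
  simpa [sub_eq_add_neg] using this

lemma Rep.cocycle {f : (Pr I n).complex.X i ⟶ M} {c : T I i M} (h : Rep n f c) :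
    (Pr I n).complex.d (i+1) i ≫ f = 0 := by
  obtain ⟨e, he, rfl⟩ := h
  exact he.cocycle

lemma Rep.exists_of_cocycle (f : (Pr I n).complex.X i ⟶ M)
    (h : (Pr I n).complex.d (i+1) i ≫ f = 0) : ∃ c, Rep n f c := by
  obtain ⟨e, he⟩ := RepK.exists_of_cocycle (K := Kc I M n) (i := i) f h
  exact ⟨_, e, he, rfl⟩

lemma Rep.map {f : (Pr I n).complex.X i ⟶ M} {c : T I i M} (h : Rep n f c) (g : M ⟶ N) :
    Rep n (f ≫ g) ((localCohomology I i).map g c) := by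
  obtain ⟨e, he, rfl⟩ := h
  have := he.map ((NatTrans.mapHomologicalComplex
    (NatTrans.rightOp ((linearYoneda R (ModuleCat.{0} R)).map g)) _).app (Pr I n).complex)
  refine ⟨_, this, ?_⟩
  have h1 := (Pr I n).leftDerived_app_eq
    (NatTrans.rightOp ((linearYoneda R (ModuleCat.{0} R)).map g)) i
  have h2 : (toE I i M n).hom ≫
      ((localCohomology.diagram (localCohomology.idealPowersDiagram I) i).obj (op (op n))).map g
      = (HomologicalComplex.homologyMap ((NatTrans.mapHomologicalComplex
    (NatTrans.rightOp ((linearYoneda R (ModuleCat.{0} R)).map g)) _).app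
      (Pr I n).complex) i).unop ≫ (toE I i N n).hom := by
    have h0 : (NatTrans.leftDerived (NatTrans.rightOp ((linearYoneda R (ModuleCat.{0} R)).map g))
        i).app (Xq I n) ≫ ((Pr I n).isoLeftDerivedObj
        ((linearYoneda R (ModuleCat.{0} R)).obj M).rightOp i).hom =
        ((Pr I n).isoLeftDerivedObj ((linearYoneda R (ModuleCat.{0} R)).obj N).rightOp i).hom ≫
        (HomologicalComplex.homologyFunctor _ (ComplexShape.down ℕ) i).map
        ((NatTrans.mapHomologicalComplex (NatTrans.rightOp ((linearYoneda R
          (ModuleCat.{0} R)).map g)) _).app (Pr I n).complex) := by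
      rw [h1, Category.assoc, Category.assoc, Iso.inv_hom_id, Category.comp_id]
    have h3 := congrArg Quiver.Hom.unop h0
    rw [unop_comp, unop_comp] at h3
    exact h3
  have h6 := (colimit.ι (localCohomology.diagram (localCohomology.idealPowersDiagram I) i)
    (op (op n))).naturality g
  have h7 := congrArg (fun q => q.hom e) h2
  have h8 := congrArg (fun q => q.hom ((toE I i M n).hom e)) h6
  dsimp at h7 h8
  erw [← h7]
  exact h8

lemma toE_trans (h : n ≤ m) : (toE I i M n).hom ≫
      ((localCohomology.diagram (localCohomology.idealPowersDiagram I) i).map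
        (homOfLE h).op.op).app M
      = (HomologicalComplex.homologyMap
    ((((linearYoneda R (ModuleCat.{0} R)).obj M).rightOp.mapHomologicalComplex _).map
      (phi I h)) i).unop ≫ (toE I i M m).hom := by
  have h1 := (Pr I m).isoLeftDerivedObj_hom_naturality (Xtr I h) (Pr I n) (phi I h)
    (phi_comm I h) ((linearYoneda R (ModuleCat.{0} R)).obj M).rightOp i
  have h3 := congrArg Quiver.Hom.unop h1
  rw [unop_comp, unop_comp] at h3
  exact h3

lemma toT_trans (h : n ≤ m) : 
      ((localCohomology.diagram (localCohomology.idealPowersDiagram I) i).map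
        (homOfLE h).op.op).app M ≫ toT I i M m = toT I i M n := by
  have := colimit.w (localCohomology.diagram (localCohomology.idealPowersDiagram I) i)
    (homOfLE h).op.op
  exact congrArg (fun q => q.app M) this

lemma Rep.trans {f : (Pr I n).complex.X i ⟶ M} {c : T I i M} (h : Rep n f c) (hnm : n ≤ m) :
    Rep m ((phi I hnm).f i ≫ f) c := by
  obtain ⟨e, he, rfl⟩ := h
  refine ⟨_, he.map ((((linearYoneda R (ModuleCat.{0} R)).obj M).rightOp.mapHomologicalComplex
    _).map (phi I hnm)), ?_⟩
  have h1 := congrArg (fun q => q.hom e) (toE_trans (I := I) (i := i) (M := M) hnm)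
  have h2 := congrArg (fun q => q.hom ((toE I i M n).hom e))
    (toT_trans (I := I) (i := i) (M := M) hnm)
  dsimp at h1 h2
  erw [← h1]
  exact h2

lemma Rep.surj (c : T I i M) : ∃ n, ∃ f : (Pr I n).complex.X i ⟶ M, Rep n f c := by
  obtain ⟨j, e, he⟩ := Concrete.isColimit_exists_rep _ (isColimitOfPreserves
    ((evaluation _ _).obj M) (colimit.isColimit
      (localCohomology.diagram (localCohomology.idealPowersDiagram I) i))) c
  obtain ⟨f, hf⟩ := RepK.surj (K := Kc I M j.unop.unop) (i := i) ((toE I i M j.unop.unop).inv e)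
  refine ⟨j.unop.unop, f, _, hf, ?_⟩
  have h1 : (toE I i M j.unop.unop).hom ((toE I i M j.unop.unop).inv e) = e :=
    congrArg (fun q => q.hom e) (toE I i M j.unop.unop).inv_hom_id
  rw [h1]
  exact he

lemma Rep.zero_of (f : (Pr I n).complex.X i ⟶ M) 
    (h : ∃ g : (Pr I n).complex.X (i-1) ⟶ M, f = (Pr I n).complex.d i (i-1) ≫ g) :
    Rep n f (0 : T I i M) := by
  obtain ⟨g, rfl⟩ := h
  exact ⟨0, (RepK.zero_iff _).2 ⟨g, rfl⟩, by simp⟩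

lemma Rep.of_zero {f : (Pr I n).complex.X i ⟶ M} (h : Rep n f (0 : T I i M)) :
    ∃ m, ∃ h : n ≤ m, ∃ g : (Pr I m).complex.X (i-1) ⟶ M,
      (phi I h).f i ≫ f = (Pr I m).complex.d i (i-1) ≫ g := by
  obtain ⟨e, he, hz⟩ := h
  have hz' : toT I i M n ((toE I i M n).hom e) = toT I i M n 0 := by rw [hz]; simp
  obtain ⟨j, k, k', hk⟩ := Concrete.isColimit_exists_of_rep_eq _ (isColimitOfPreserves
    ((evaluation _ _).obj M) (colimit.isColimit
      (localCohomology.diagram (localCohomology.idealPowersDiagram I) i))) _ _ hz'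
  have hnm : n ≤ j.unop.unop := leOfHom k.unop.unop
  refine ⟨j.unop.unop, hnm, ?_⟩
  have h1 := he.map ((((linearYoneda R (ModuleCat.{0} R)).obj M).rightOp.mapHomologicalComplex
    _).map (phi I hnm))
  have h2 := congrArg (fun q => q.hom e) (toE_trans (I := I) (i := i) (M := M) hnm)
  have h3 : ((localCohomology.diagram (localCohomology.idealPowersDiagram I) i).map
        (homOfLE hnm).op.op).app M ((toE I i M n).hom e) = 0 := by
    refine Eq.trans hk ?_
    exact map_zero (ModuleCat.Hom.hom _)
  have h4 := h2.symm.trans h3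
  have h5 : (toE I i M j.unop.unop).hom ((HomologicalComplex.homologyMap
    ((((linearYoneda R (ModuleCat.{0} R)).obj M).rightOp.mapHomologicalComplex _).map
      (phi I hnm)) i).unop e) = (toE I i M j.unop.unop).hom 0 := by
    rw [map_zero]; exact h4
  have h6 := (ModuleCat.mono_iff_injective (toE I i M j.unop.unop).hom).1 inferInstance h5
  rw [h6] at h1
  obtain ⟨g, hg⟩ := (RepK.zero_iff _).1 h1
  exact ⟨g, hg.symm⟩

lemma Rep.unique {f : (Pr I n).complex.X i ⟶ M} {c c' : T I i M} (h : Rep n f c)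
    (h' : Rep n f c') : c = c' := by
  have h1 := h.sub h'
  rw [sub_self] at h1
  obtain ⟨e, ⟨z, hz, hze⟩, hc⟩ := h1
  have : z = 0 := pOp_inj (by rw [hz, map_zero]; rfl)
  subst this
  rw [map_zero] at hze
  subst hze
  rw [map_zero, map_zero] at hc
  exact (sub_eq_zero.1 hc.symm)

end loc

section les
variable {R : Type} [CommRing R] (I : Ideal R)

/-- Local cohomology of an unbundled module. -/
abbrev H (i : ℕ) (A : Type) [AddCommGroup A] [Module R A] : Type :=
  (localCohomology I i).obj (ModuleCat.of R A)

variable {A B C A' B' C' : Type} [AddCommGroup A] [Module R A] [AddCommGroup B] [Module R B]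
  [AddCommGroup C] [Module R C] [AddCommGroup A'] [Module R A'] [AddCommGroup B'] [Module R B']
  [AddCommGroup C'] [Module R C']

/-- The map on local cohomology. -/
noncomputable def Hmap (i : ℕ) (g : A →ₗ[R] B) : H I i A →ₗ[R] H I i B :=
  ((localCohomology I i).map (ModuleCat.ofHom g)).hom

variable {I} {i n m : ℕ}

lemma Rep.Hmap {f : (Pr I n).complex.X i ⟶ ModuleCat.of R A} {c : H I i A} (h : Rep n f c)
    (g : A →ₗ[R] B) : Rep n (f ≫ ModuleCat.ofHom g) (Hmap I i g c) := Rep.map h _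

lemma Hmap_comp (g : A →ₗ[R] B) (g' : B →ₗ[R] C) (c : H I i A) :
    Hmap I i (g' ∘ₗ g) c = Hmap I i g' (Hmap I i g c) := by
  obtain ⟨n, f, hf⟩ := Rep.surj c
  exact (hf.Hmap _).unique ((hf.Hmap g).Hmap g')

lemma Hmap_add (g g' : A →ₗ[R] B) (c : H I i A) :
    Hmap I i (g + g') c = Hmap I i g c + Hmap I i g' c := by
  obtain ⟨n, f, hf⟩ := Rep.surj c
  have := (hf.Hmap g).add (hf.Hmap g')
  rw [← Preadditive.comp_add] at this
  exact (hf.Hmap _).unique this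

lemma Hmap_smul (r : R) (g : A →ₗ[R] B) (c : H I i A) :
    Hmap I i (r • g) c = r • Hmap I i g c := by
  obtain ⟨n, f, hf⟩ := Rep.surj c
  have := (hf.Hmap g).smul r
  rw [← Linear.comp_smul] at this
  exact (hf.Hmap _).unique this

lemma Hmap_id (c : H I i A) : Hmap I i LinearMap.id c = c := by
  obtain ⟨n, f, hf⟩ := Rep.surj c
  have := hf.Hmap LinearMap.id
  exact this.unique hf

lemma Hmap_zero (c : H I i A) : Hmap I i (0 : A →ₗ[R] B) c = 0 := by
  have := Hmap_smul (I := I) (0 : R) (0 : A →ₗ[R] B) c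
  simpa using this

lemma lift_ker {ι : A →ₗ[R] B} {π : B →ₗ[R] C} (hι : Function.Injective ι)
    (hex : Function.Exact ι π) {X : ModuleCat.{0} R} (b : X ⟶ ModuleCat.of R B)
    (h : b ≫ ModuleCat.ofHom π = 0) : ∃ f : X ⟶ ModuleCat.of R A, f ≫ ModuleCat.ofHom ι = b := by
  have hx : ∀ x, b.hom x ∈ LinearMap.range ι := fun x =>
    (hex _).1 (congrArg (fun q => q.hom x) h)
  refine ⟨ModuleCat.ofHom ((LinearEquiv.ofInjective ι hι).symm.toLinearMap ∘ₗ
    LinearMap.codRestrict _ b.hom hx), ?_⟩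
  ext x
  change ι ((LinearEquiv.ofInjective ι hι).symm ⟨b.hom x, hx x⟩) = b.hom x
  have := LinearEquiv.apply_symm_apply (LinearEquiv.ofInjective ι hι) ⟨b.hom x, hx x⟩
  exact congrArg Subtype.val this

lemma lift_surj {π : B →ₗ[R] C} (hπ : Function.Surjective π) {X : ModuleCat.{0} R} [Projective X]
    (c : X ⟶ ModuleCat.of R C) : ∃ b : X ⟶ ModuleCat.of R B, b ≫ ModuleCat.ofHom π = c := by
  have : Epi (ModuleCat.ofHom π) := (ModuleCat.epi_iff_surjective _).2 hπ
  exact ⟨Projective.factorThru c (ModuleCat.ofHom π), Projective.factorThru_comp _ _⟩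

lemma cancel_inj {ι : A →ₗ[R] B} (hι : Function.Injective ι) {X : ModuleCat.{0} R}
    {f g : X ⟶ ModuleCat.of R A} (h : f ≫ ModuleCat.ofHom ι = g ≫ ModuleCat.ofHom ι) : f = g := by
  have : Mono (ModuleCat.ofHom ι) := (ModuleCat.mono_iff_injective _).2 hι
  exact (cancel_mono _).1 h

instance (n i : ℕ) : Projective ((Pr I n).complex.X i) := (Pr I n).projective i

/-- The connecting relation. -/
def Link (ι : A →ₗ[R] B) (π : B →ₗ[R] C) (c : H I i C) (a : H I (i+1) A) : Prop :=
  ∃ n, ∃ (b : (Pr I n).complex.X i ⟶ ModuleCat.of R B)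
    (f : (Pr I n).complex.X (i+1) ⟶ ModuleCat.of R A),
    f ≫ ModuleCat.ofHom ι = (Pr I n).complex.d (i+1) i ≫ b ∧
    Rep n (b ≫ ModuleCat.ofHom π) c ∧ Rep n f a

variable {ι : A →ₗ[R] B} {π : B →ₗ[R] C}

lemma link_at (h : n ≤ m) {b : (Pr I n).complex.X i ⟶ ModuleCat.of R B}
    {f : (Pr I n).complex.X (i+1) ⟶ ModuleCat.of R A}
    (hf : f ≫ ModuleCat.ofHom ι = (Pr I n).complex.d (i+1) i ≫ b) :
    ((phi I h).f (i+1) ≫ f) ≫ ModuleCat.ofHom ι =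
      (Pr I m).complex.d (i+1) i ≫ ((phi I h).f i ≫ b) := by
  rw [Category.assoc, hf]
  simp

lemma Link.add {c c' : H I i C} {a a' : H I (i+1) A} (h : Link ι π c a) (h' : Link ι π c' a') :
    Link ι π (c + c') (a + a') := by
  obtain ⟨n, b, f, h1, h2, h3⟩ := h
  obtain ⟨n', b', f', h1', h2', h3'⟩ := h'
  have k := link_at (le_max_left n n') h1
  have k' := link_at (le_max_right n n') h1'
  refine ⟨max n n', (phi I (le_max_left n n')).f i ≫ b + (phi I (le_max_right n n')).f i ≫ b', _,
    ?_, ?_, (h3.trans (le_max_left n n')).add (h3'.trans (le_max_right n n'))⟩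
  · rw [Preadditive.add_comp, k, k', Preadditive.comp_add]
  · rw [Preadditive.add_comp, Category.assoc, Category.assoc]
    exact (h2.trans _).add (h2'.trans _)

lemma Link.smul (r : R) {c : H I i C} {a : H I (i+1) A} (h : Link ι π c a) :
    Link ι π (r • c) (r • a) := by
  obtain ⟨n, b, f, h1, h2, h3⟩ := h
  refine ⟨n, r • b, r • f, ?_, ?_, h3.smul r⟩
  · rw [Linear.smul_comp, h1, Linear.comp_smul]
  · rw [Linear.smul_comp]; exact h2.smul r

lemma Link.exists (hι : Function.Injective ι) (hex : Function.Exact ι π)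
    (hπ : Function.Surjective π) (c : H I i C) : ∃ a, Link ι π c a := by
  obtain ⟨n, g, hg⟩ := Rep.surj c
  obtain ⟨b, rfl⟩ := lift_surj hπ g
  obtain ⟨f, hf⟩ := lift_ker hι hex ((Pr I n).complex.d (i+1) i ≫ b)
    (by rw [Category.assoc]; exact hg.cocycle)
  obtain ⟨a, ha⟩ := Rep.exists_of_cocycle f (cancel_inj hι (by
    rw [Category.assoc, hf]; simp))
  exact ⟨a, n, b, f, hf, hg, ha⟩

lemma Link.zero (hι : Function.Injective ι) (hex : Function.Exact ι π)
    (hπ : Function.Surjective π) {a : H I (i+1) A} (h : Link ι π 0 a) : a = 0 := by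
  obtain ⟨n, b, f, h1, h2, h3⟩ := h
  obtain ⟨m, hnm, g, hg⟩ := h2.of_zero
  obtain ⟨g, rfl⟩ := lift_surj hπ g
  obtain ⟨b', hb'⟩ := lift_ker hι hex ((phi I hnm).f i ≫ b - (Pr I m).complex.d i (i-1) ≫ g) (by
    rw [Preadditive.sub_comp, Category.assoc, Category.assoc, hg, sub_self])
  have h4 := link_at hnm h1
  have h5 : (phi I hnm).f (i+1) ≫ f = (Pr I m).complex.d (i+1) i ≫ b' := by
    apply cancel_inj hι
    rw [h4, Category.assoc, hb', Preadditive.comp_sub]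
    simp
  exact (h3.trans hnm).unique (Rep.zero_of _ ⟨b', h5⟩)

lemma Link.unique (hι : Function.Injective ι) (hex : Function.Exact ι π)
    (hπ : Function.Surjective π) {c : H I i C} {a a' : H I (i+1) A} (h : Link ι π c a)
    (h' : Link ι π c a') : a = a' := by
  have := h.add (h'.smul (-1))
  simp only [neg_smul, one_smul, add_neg_cancel] at this
  have := Link.zero hι hex hπ this
  exact add_neg_eq_zero.1 this

variable (I i) in
/-- The connecting map. -/
noncomputable def del (hι : Function.Injective ι) (hex : Function.Exact ι π)
    (hπ : Function.Surjective π) : H I i C →ₗ[R] H I (i+1) A where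
  toFun c := (Link.exists hι hex hπ c).choose
  map_add' c c' := Link.unique hι hex hπ (Link.exists hι hex hπ _).choose_spec
    ((Link.exists hι hex hπ c).choose_spec.add (Link.exists hι hex hπ c').choose_spec)
  map_smul' r c := Link.unique hι hex hπ (Link.exists hι hex hπ _).choose_spec
    ((Link.exists hι hex hπ c).choose_spec.smul r)

lemma exact_mid (hι : Function.Injective ι) (hex : Function.Exact ι π)
    (hπ : Function.Surjective π) (b : H I i B) (h : Hmap I i π b = 0) : ∃ a, Hmap I i ι a = b := by
  obtain ⟨n, f, hf⟩ := Rep.surj b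
  have h1 := hf.Hmap π
  rw [h] at h1
  obtain ⟨m, hnm, g, hg⟩ := h1.of_zero
  obtain ⟨g, rfl⟩ := lift_surj hπ g
  obtain ⟨f', hf'⟩ := lift_ker hι hex ((phi I hnm).f i ≫ f - (Pr I m).complex.d i (i-1) ≫ g) (by
    rw [Preadditive.sub_comp, Category.assoc, Category.assoc, hg, sub_self])
  have h2 := (hf.trans hnm).sub (Rep.zero_of ((Pr I m).complex.d i (i-1) ≫ g) ⟨g, rfl⟩)
  rw [sub_zero, ← hf'] at h2
  obtain ⟨a, ha⟩ := Rep.exists_of_cocycle f' (cancel_inj hι (by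
    rw [Category.assoc, h2.cocycle, zero_comp]))
  exact ⟨a, (ha.Hmap ι).unique h2⟩

variable (hι : Function.Injective ι) (hex : Function.Exact ι π) (hπ : Function.Surjective π)

lemma link_del (c : H I i C) : Link ι π c (del I i hι hex hπ c) :=
  (Link.exists hι hex hπ c).choose_spec

lemma exact_right (c : H I i C) (h : del I i hι hex hπ c = 0) : ∃ b, Hmap I i π b = c := by
  have hl := link_del hι hex hπ c
  rw [h] at hl
  obtain ⟨n, b, f, h1, h2, h3⟩ := hl
  obtain ⟨m, hnm, g, hg⟩ := h3.of_zero
  replace h1 := link_at hnm h1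
  obtain ⟨z, hz⟩ := Rep.exists_of_cocycle ((phi I hnm).f i ≫ b -
    (show (Pr I m).complex.X i ⟶ _ from g) ≫ ModuleCat.ofHom ι) (by
      rw [Preadditive.comp_sub, ← h1, hg]
      simp)
  refine ⟨z, (hz.Hmap π).unique ?_⟩
  have h4 : ModuleCat.ofHom ι ≫ ModuleCat.ofHom π = 0 := by
    ext x; exact hex.apply_apply_eq_zero x
  rw [Preadditive.sub_comp, Category.assoc, Category.assoc, h4, comp_zero, sub_zero]
  exact h2.trans hnm

lemma del_map (b : H I i B) : del I i hι hex hπ (Hmap I i π b) = 0 := by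
  obtain ⟨n, f, hf⟩ := Rep.surj b
  refine Link.unique hι hex hπ (link_del hι hex hπ _) ⟨n, f, 0, ?_, hf.Hmap π, ?_⟩
  · rw [zero_comp, hf.cocycle]
  · exact Rep.zero_of _ ⟨0, by simp⟩

lemma exact_left (a : H I (i+1) A) (h : Hmap I (i+1) ι a = 0) :
    ∃ c, del I i hι hex hπ c = a := by
  obtain ⟨n, f, hf⟩ := Rep.surj a
  have h1 := hf.Hmap ι
  rw [h] at h1
  obtain ⟨m, hnm, g, hg⟩ := h1.of_zero
  have h4 : ModuleCat.ofHom ι ≫ ModuleCat.ofHom π = 0 := by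
    ext x; exact hex.apply_apply_eq_zero x
  obtain ⟨c, hc⟩ := Rep.exists_of_cocycle (i := i)
    ((show (Pr I m).complex.X i ⟶ _ from g) ≫ ModuleCat.ofHom π) (by
    have h5 : (Pr I m).complex.d (i+1) i ≫ (show (Pr I m).complex.X i ⟶ _ from g) =
      (phi I hnm).f (i+1) ≫ f ≫ ModuleCat.ofHom ι := hg.symm
    rw [← Category.assoc, h5, Category.assoc, Category.assoc, h4, comp_zero, comp_zero])
  refine ⟨c, Link.unique hι hex hπ (link_del hι hex hπ _) ⟨m, g, (phi I hnm).f (i+1) ≫ f, ?_, hc,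
    hf.trans hnm⟩⟩
  rw [Category.assoc]; exact hg

lemma del_natural {ι' : A' →ₗ[R] B'} {π' : B' →ₗ[R] C'} (hι' : Function.Injective ι')
    (hex' : Function.Exact ι' π') (hπ' : Function.Surjective π')
    (α : A →ₗ[R] A') (β : B →ₗ[R] B') (γ : C →ₗ[R] C')
    (h1 : ι' ∘ₗ α = β ∘ₗ ι) (h2 : π' ∘ₗ β = γ ∘ₗ π) (c : H I i C) :
    del I i hι' hex' hπ' (Hmap I i γ c) = Hmap I (i+1) α (del I i hι hex hπ c) := by
  obtain ⟨n, b, f, k1, k2, k3⟩ := link_del hι hex hπ c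
  refine Link.unique hι' hex' hπ' (link_del hι' hex' hπ' _) ⟨n, b ≫ ModuleCat.ofHom β,
    f ≫ ModuleCat.ofHom α, ?_, ?_, k3.Hmap α⟩
  · rw [← Category.assoc, ← k1, Category.assoc, Category.assoc, ← ModuleCat.ofHom_comp,
      ← ModuleCat.ofHom_comp, h1]
  · have := k2.Hmap γ
    rw [Category.assoc, ← ModuleCat.ofHom_comp] at this ⊢
    rw [h2]; exact this

end les

section tors
variable {R : Type} [CommRing R] {I : Ideal R}

/-- Torsion modules. -/
def IsTor (I : Ideal R) (A : Type) [AddCommGroup A] [Module R A] : Prop :=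
  ∀ a : A, ∃ n : ℕ, ∀ r ∈ I ^ n, r • a = 0

variable {A B C : Type} [AddCommGroup A] [Module R A] [AddCommGroup B] [Module R B]
  [AddCommGroup C] [Module R C] {i n m : ℕ}

lemma H_injective_zero [Module.Injective R A] (c : H I (i+1) A) : c = 0 := by
  have : Injective (ModuleCat.of R A) := Module.injective_object_of_injective_module R A
  obtain ⟨n, f, hf⟩ := Rep.surj c
  have hex := (Pr I n).exact_succ i
  refine hf.unique (Rep.zero_of f ⟨hex.descToInjective f hf.cocycle, ?_⟩)
  exact (hex.comp_descToInjective f hf.cocycle).symm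

/-- The map `R / I ^ n → A` given by a torsion element. -/
def evMap (a : A) (n : ℕ) (h : ∀ r ∈ I ^ n, r • a = 0) : Xq I n ⟶ ModuleCat.of R A :=
  ModuleCat.ofHom ((I ^ n).liftQ (LinearMap.toSpanSingleton R A a) (fun r hr => h r hr))

variable (I n) in
/-- the element `1`. -/
def one : Xq I n := (Submodule.Quotient.mk (1 : R) : R ⧸ I ^ n)

variable (I n) in
/-- The augmentation. -/
noncomputable def pim : (Pr I n).complex.X 0 ⟶ Xq I n := (Pr I n).π.f 0

instance : Epi (pim I n) := inferInstanceAs (Epi ((Pr I n).π.f 0))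

lemma d_pim : (Pr I n).complex.d (0+1) 0 ≫ pim I n = 0 := (Pr I n).complex_d_comp_π_f_zero

lemma phi_pim (h : n ≤ m) : (phi I h).f 0 ≫ pim I n = pim I m ≫ Xtr I h := phi_comm I h

lemma smul_one_eq (r : R) (hr : r ∈ I ^ n) : r • one I n = 0 := by
  have : (Submodule.Quotient.mk (r • (1 : R)) : R ⧸ I ^ n) = 0 := by
    rw [Submodule.Quotient.mk_eq_zero]; simpa using hr
  exact this

lemma Xtr_one (h : n ≤ m) : (Xtr I h).hom (one I m) = one I n := rfl

lemma evMap_one (a : A) (n : ℕ) (h : ∀ r ∈ I ^ n, r • a = 0) :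
    (evMap a n h).hom (one I n) = a := by
  change (LinearMap.toSpanSingleton R A a) 1 = a
  simp

lemma Xq_hom_ext {f g : Xq I n ⟶ ModuleCat.of R A}
    (h : f.hom (one I n) = g.hom (one I n)) : f = g := by
  apply ModuleCat.hom_ext
  apply Submodule.linearMap_qext
  apply LinearMap.ext_ring
  exact h

/-- `c` is the class of the torsion element `a`. -/
def Cls (a : A) (c : H I 0 A) : Prop :=
  ∃ n, ∃ f : Xq I n ⟶ ModuleCat.of R A, f.hom (one I n) = a ∧ Rep n (pim I n ≫ f) c

lemma pi_cocycle (f : Xq I n ⟶ ModuleCat.of R A) :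
    (Pr I n).complex.d (0+1) 0 ≫ (pim I n ≫ f) = 0 := by
  rw [← Category.assoc, d_pim, zero_comp]

lemma Cls.exists (a : A) (h : ∀ r ∈ I ^ n, r • a = 0) : ∃ c : H I 0 A, Cls a c := by
  obtain ⟨c, hc⟩ := Rep.exists_of_cocycle _ (pi_cocycle (evMap a n h))
  exact ⟨c, n, _, evMap_one a n h, hc⟩

lemma Cls.surj (c : H I 0 A) : ∃ a : A, Cls a c := by
  obtain ⟨n, f, hf⟩ := Rep.surj c
  have hex := (Pr I n).exact₀
  have : Epi ((Pr I n).π.f 0) := inferInstance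
  obtain ⟨g, hg⟩ : ∃ g : Xq I n ⟶ ModuleCat.of R A, pim I n ≫ g = f :=
    ⟨hex.desc f hf.cocycle, hex.g_desc f hf.cocycle⟩
  subst hg
  exact ⟨_, n, g, rfl, hf⟩

lemma Cls.tors {a : A} {c : H I 0 A} (h : Cls a c) : ∃ n, ∀ r ∈ I ^ n, r • a = 0 := by
  obtain ⟨n, f, rfl, -⟩ := h
  refine ⟨n, fun r hr => ?_⟩
  exact (map_smul f.hom r (one I n)).symm.trans
    ((congrArg f.hom (smul_one_eq r hr)).trans (map_zero f.hom))

lemma Cls.smul (r : R) {a : A} {c : H I 0 A} (h : Cls a c) : Cls (r • a) (r • c) := by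
  obtain ⟨n, f, rfl, hf⟩ := h
  refine ⟨n, r • f, rfl, ?_⟩
  rw [Linear.comp_smul]
  exact hf.smul r

lemma Cls.map {a : A} {c : H I 0 A} (h : Cls a c) (g : A →ₗ[R] B) : Cls (g a) (Hmap I 0 g c) := by
  obtain ⟨n, f, rfl, hf⟩ := h
  refine ⟨n, f ≫ ModuleCat.ofHom g, rfl, ?_⟩
  rw [← Category.assoc]
  exact hf.Hmap g

lemma phi_ev (h : n ≤ m) (f : Xq I n ⟶ ModuleCat.of R A) :
    (phi I h).f 0 ≫ pim I n ≫ f = pim I m ≫ (Xtr I h ≫ f) := by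
  rw [← Category.assoc, phi_pim, Category.assoc]

lemma Cls.eq_zero {a : A} (h : Cls a (0 : H I 0 A)) : a = 0 := by
  obtain ⟨n, f, rfl, hf⟩ := h
  obtain ⟨m, hnm, g, hg⟩ := hf.of_zero
  rw [phi_ev] at hg
  have h0 : (Pr I m).complex.d 0 (0-1) = 0 := (Pr I m).complex.shape _ _ (by simp)
  rw [h0, zero_comp] at hg
  have h1 : Xtr I hnm ≫ f = 0 := by
    rw [← cancel_epi (pim I m), comp_zero]
    exact hg
  exact congrArg (fun q => q.hom (one I m)) h1

lemma Cls.unique {a : A} {c c' : H I 0 A} (h : Cls a c) (h' : Cls a c') : c = c' := by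
  obtain ⟨n, f, rfl, hf⟩ := h
  obtain ⟨n', f', h1, hf'⟩ := h'
  have k := hf.trans (le_max_left n n')
  have k' := hf'.trans (le_max_right n n')
  rw [phi_ev] at k k'
  have h2 : Xtr I (le_max_left n n') ≫ f = Xtr I (le_max_right n n') ≫ f' := Xq_hom_ext h1.symm
  rw [h2] at k
  exact k.unique k'

lemma H0_surj {π : B →ₗ[R] C} (hπ : Function.Surjective π) (hB : IsTor I B) (c : H I 0 C) :
    ∃ b, Hmap I 0 π b = c := by
  obtain ⟨x, hx⟩ := Cls.surj c
  obtain ⟨y, rfl⟩ := hπ x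
  obtain ⟨n, hn⟩ := hB y
  obtain ⟨b, hb⟩ := Cls.exists y hn
  exact ⟨b, (hb.map π).unique hx⟩

/-- annihilators of `H^0` annihilate torsion elements -/
lemma smul_eq_zero_of_H0 {r : R} (h : ∀ c : H I 0 A, r • c = 0) {a : A}
    (ha : ∀ s ∈ I ^ n, s • a = 0) : r • a = 0 := by
  obtain ⟨c, hc⟩ := Cls.exists a ha
  have := hc.smul r
  rw [h] at this
  exact this.eq_zero

variable (I A) in
/-- The torsion submodule. -/
def Gam : Submodule R A where
  carrier := {a | ∃ n : ℕ, ∀ r ∈ I ^ n, r • a = 0}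
  zero_mem' := ⟨0, by simp⟩
  add_mem' := by
    rintro a b ⟨n, hn⟩ ⟨m, hm⟩
    refine ⟨n + m, fun r hr => ?_⟩
    rw [smul_add, hn r (Ideal.pow_le_pow_right (by simp) hr),
      hm r (Ideal.pow_le_pow_right (by simp) hr), add_zero]
  smul_mem' := by
    rintro r a ⟨n, hn⟩
    exact ⟨n, fun s hs => by rw [smul_comm, hn s hs, smul_zero]⟩

lemma isTor_Gam : IsTor I (Gam I A) := by
  rintro ⟨a, n, hn⟩
  exact ⟨n, fun r hr => Subtype.ext (hn r hr)⟩

lemma IsTor.of_surj (h : IsTor I A) {π : A →ₗ[R] B} (hπ : Function.Surjective π) : IsTor I B := by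
  intro b
  obtain ⟨a, rfl⟩ := hπ b
  obtain ⟨n, hn⟩ := h a
  exact ⟨n, fun r hr => by rw [← map_smul, hn r hr, map_zero]⟩

/-- a finitely generated torsion module is killed by a power -/
lemma IsTor.bounded [Module.Finite R A] (h : IsTor I A) : ∃ n, ∀ r ∈ I ^ n, ∀ a : A, r • a = 0 := by
  obtain ⟨s, hs⟩ := (Module.Finite.fg_top : (⊤ : Submodule R A).FG)
  choose N hN using h
  refine ⟨s.sup N, fun r hr a => ?_⟩
  have : (⊤ : Submodule R A) ≤ LinearMap.ker (LinearMap.lsmul R A r) := by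
    rw [← hs, Submodule.span_le]
    intro x hx
    exact hN x r (Ideal.pow_le_pow_right (Finset.le_sup hx) hr)
  exact this (Submodule.mem_top (x := a))

/-- The torsion part of an injective module is injective (Noetherian case). -/
lemma injective_Gam [IsNoetherianRing R] [Module.Injective R A] :
    Module.Injective R (Gam I A) := by
  apply Module.Baer.injective
  intro J g
  have hr : IsTor I (LinearMap.range g) := by
    rintro ⟨⟨a, n, hn⟩, ha⟩
    exact ⟨n, fun r hr => Subtype.ext (Subtype.ext (hn r hr))⟩
  obtain ⟨k, hk⟩ := hr.bounded
  obtain ⟨c, hc⟩ := Ideal.exists_pow_inf_eq_pow_smul I J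
  have h1 : ∀ x (hx : x ∈ J), x ∈ I ^ (k + c) → g ⟨x, hx⟩ = 0 := by
    intro x hx hxI
    have h2 : x ∈ I ^ (k + c) • (⊤ : Submodule R R) ⊓ J := ⟨by simpa using hxI, hx⟩
    rw [hc (k+c) (by omega), Nat.add_sub_cancel] at h2
    have h3 : I ^ k • (I ^ c • (⊤ : Submodule R R) ⊓ J) ≤ Submodule.map J.subtype (LinearMap.ker g) := by
      rw [Submodule.smul_le]
      rintro r hr y ⟨-, hy⟩
      refine ⟨⟨r • y, J.smul_mem r hy⟩, ?_, rfl⟩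
      have := hk r hr ⟨g ⟨y, hy⟩, ⟨_, rfl⟩⟩
      have h4 : r • g ⟨y, hy⟩ = 0 := congrArg Subtype.val this
      rw [← map_smul] at h4
      exact h4
    obtain ⟨⟨y, hy⟩, h5, h6⟩ := h3 h2
    subst h6
    exact h5
  -- extend by zero to `J + I ^ (k + c)`
  let q := (I ^ (k + c)).mkQ
  let J' : Submodule R (R ⧸ I ^ (k + c)) := Submodule.map q J
  let p : J →ₗ[R] J' := q.submoduleMap J
  have hp : Function.Surjective p := LinearMap.submoduleMap_surjective _ _
  have hker : LinearMap.ker p ≤ LinearMap.ker g := by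
    rintro ⟨x, hx⟩ h
    refine h1 x hx ?_
    have : q x = 0 := congrArg Subtype.val h
    exact (Submodule.Quotient.mk_eq_zero _).1 this
  let e := (LinearMap.quotKerEquivOfSurjective p hp)
  let g' : J' →ₗ[R] A := (Gam I A).subtype ∘ₗ (Submodule.liftQ _ g hker) ∘ₗ e.symm.toLinearMap
  have hg' : ∀ x, g' (p x) = (g x : A) := by
    intro x
    have : e.symm (p x) = Submodule.Quotient.mk x := by
      rw [LinearEquiv.symm_apply_eq]; rfl
    simp only [g', LinearMap.comp_apply, LinearEquiv.coe_coe, this]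
    rfl
  obtain ⟨G, hG⟩ := Module.Injective.out (R := R) (Q := A) J'.subtype J'.injective_subtype g'
  refine ⟨LinearMap.codRestrict (Gam I A) (G ∘ₗ q) (fun r => ⟨k + c, fun s hs => ?_⟩), ?_⟩
  · have : s • q r = 0 := by
      rw [← map_smul]
      exact (Submodule.Quotient.mk_eq_zero _).2 (Ideal.mul_mem_right _ _ hs)
    rw [LinearMap.comp_apply, ← map_smul, this, map_zero]
  · intro x hx
    apply Subtype.ext
    have := hG (p ⟨x, hx⟩)
    rw [hg'] at this
    exact this

lemma exists_tor_embedding [IsNoetherianRing R] (hA : IsTor I A) :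
    ∃ (E : Type) (_ : AddCommGroup E) (_ : Module R E) (ι : A →ₗ[R] E),
      Module.Injective R E ∧ IsTor I E ∧ Function.Injective ι := by
  let P := Injective.under (ModuleCat.of R A)
  have : Module.Injective R P := by
    have : Injective (ModuleCat.of R P) := inferInstanceAs (Injective P)
    exact Module.injective_module_of_injective_object R P
  let j : A →ₗ[R] P := (Injective.ι (ModuleCat.of R A)).hom
  have hj : Function.Injective j := (ModuleCat.mono_iff_injective _).1 inferInstance
  refine ⟨Gam I P, inferInstance, inferInstance, LinearMap.codRestrict (Gam I P) j (fun a => ?_),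
    injective_Gam, isTor_Gam, fun a b h => hj (congrArg Subtype.val h)⟩
  obtain ⟨n, hn⟩ := hA a
  exact ⟨n, fun r hr => by rw [← map_smul, hn r hr, map_zero]⟩

lemma H_tor_zero [IsNoetherianRing R] : ∀ (i : ℕ) {A : Type} [AddCommGroup A] [Module R A],
    IsTor I A → ∀ c : H I (i+1) A, c = 0 := by
  intro i
  induction i with
  | zero =>
    intro A _ _ hA c
    obtain ⟨E, _, _, ι, hE, hT, hι⟩ := exists_tor_embedding hA
    have hex : Function.Exact ι (LinearMap.range ι).mkQ := LinearMap.exact_map_mkQ_range ι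
    have hπ := (LinearMap.range ι).mkQ_surjective
    obtain ⟨q, rfl⟩ := exact_left hι hex hπ c (H_injective_zero _)
    obtain ⟨e, rfl⟩ := H0_surj hπ hT q
    exact del_map hι hex hπ e
  | succ i ih =>
    intro A _ _ hA c
    obtain ⟨E, _, _, ι, hE, hT, hι⟩ := exists_tor_embedding hA
    have hex : Function.Exact ι (LinearMap.range ι).mkQ := LinearMap.exact_map_mkQ_range ι
    have hπ := (LinearMap.range ι).mkQ_surjective
    obtain ⟨q, rfl⟩ := exact_left hι hex hπ c (H_injective_zero _)
    rw [ih (hT.of_surj hπ) q, map_zero]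
end tors

section dim
variable {R : Type} [CommRing R]

/-- dimension of `R / a` at most `t`. -/
def Dle (a : Ideal R) (t : ℕ) : Prop :=
  ∀ s : LTSeries (PrimeSpectrum.zeroLocus (a : Set R)), s.length ≤ t

lemma Dle.of_dim {a : Ideal R} {t : ℕ} (h : ringKrullDim (R ⧸ a) ≤ (t : WithBot (WithTop ℕ))) :
    Dle a t := by
  intro s
  rw [ringKrullDim_quotient] at h
  have := (Order.LTSeries.length_le_krullDim s).trans h
  exact WithTop.coe_le_coe.1 (WithBot.coe_le_coe.1 this)

lemma Dle.mono {a b : Ideal R} {t : ℕ} (h : Dle a t)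
    (hs : PrimeSpectrum.zeroLocus (b : Set R) ⊆ PrimeSpectrum.zeroLocus (a : Set R)) : Dle b t := by
  intro s
  exact h (s.map (Set.inclusion hs) (fun _ _ h => h))

variable [IsLocalRing R]

lemma Dle.zero [IsNoetherianRing R] {a : Ideal R} (h : Dle a 0) :
    ∃ n, (maximalIdeal R) ^ n ≤ a := by
  apply Ideal.exists_pow_le_of_le_radical_of_fg _ (IsNoetherian.noetherian _)
  rw [Ideal.radical_eq_sInf]
  refine le_sInf ?_
  rintro p ⟨hap, hp⟩
  by_contra hn
  have hle : p ≤ maximalIdeal R := le_maximalIdeal hp.ne_top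
  have hlt : p < maximalIdeal R := lt_of_le_of_ne hle (fun h => hn h.ge)
  let P : PrimeSpectrum.zeroLocus (a : Set R) := ⟨⟨p, hp⟩, hap⟩
  let Q : PrimeSpectrum.zeroLocus (a : Set R) :=
    ⟨⟨maximalIdeal R, inferInstance⟩, hap.trans hle⟩
  have hPQ : P < Q := hlt
  let s : LTSeries (PrimeSpectrum.zeroLocus (a : Set R)) :=
    (RelSeries.singleton _ Q).cons P hPQ
  have := h s
  exact absurd (this : s.length ≤ 0) (Nat.not_succ_le_zero _)

lemma Dle.succ {a : Ideal R} {t : ℕ} (h : Dle a (t+1)) {y : R}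
    (hy : ∀ p ∈ a.minimalPrimes, p ≠ maximalIdeal R → y ∉ p) : Dle (a ⊔ Ideal.span {y}) t := by
  intro s
  have ha : a ≤ s.head.1.asIdeal := le_sup_left.trans s.head.2
  have hyh : y ∈ s.head.1.asIdeal :=
    s.head.2 (Ideal.mem_sup_right (Ideal.mem_span_singleton_self y))
  have := s.head.1.isPrime
  obtain ⟨q, hq, hqs⟩ := Ideal.exists_minimalPrimes_le ha
  by_cases hqm : q = maximalIdeal R
  · have : s.length = 0 := by
      by_contra h0
      have h1 : s.head < s.last := by
        refine s.strictMono (Fin.lt_def.2 ?_)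
        exact Nat.pos_of_ne_zero h0
      have h2 : s.head.1.asIdeal < s.last.1.asIdeal := h1
      have h3 : s.last.1.asIdeal ≤ maximalIdeal R := le_maximalIdeal s.last.1.isPrime.ne_top
      rw [← hqm] at h3
      exact absurd (h2.trans_le (h3.trans hqs)) (lt_irrefl _)
    omega
  · have hyq := hy q hq hqm
    have hsub : PrimeSpectrum.zeroLocus ((a ⊔ Ideal.span {y} : Ideal R) : Set R) ⊆
        PrimeSpectrum.zeroLocus (a : Set R) := fun p hp => (le_sup_left (a := a)).trans hp
    let Q : PrimeSpectrum.zeroLocus (a : Set R) := ⟨⟨q, hq.1.1⟩, hq.1.2⟩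
    let s' := s.map (Set.inclusion hsub) (fun _ _ h => h)
    have hlt : Q < s'.head := by
      have : q < s.head.1.asIdeal := lt_of_le_of_ne hqs (fun h => hyq (h ▸ hyh))
      exact this
    have := h (s'.cons Q hlt)
    simp [s'] at this
    exact this

end dim

section torlem
variable {R : Type} [CommRing R]

lemma Gam_quot [IsNoetherianRing R] {I : Ideal R} {M : Type} [AddCommGroup M] [Module R M] [Module.Finite R M]
    {u : M} {n : ℕ} (h : ∀ r ∈ I ^ n, r • u ∈ Gam I M) : u ∈ Gam I M := by
  have : IsNoetherian R M := isNoetherian_of_isNoetherianRing_of_finite R M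
  obtain ⟨k, hk⟩ := (isTor_Gam (I := I) (A := M)).bounded
  refine ⟨k + n, fun r hr => ?_⟩
  rw [pow_add] at hr
  refine Submodule.mul_induction_on hr (fun p hp q hq => ?_) (fun p q hp hq => ?_)
  · rw [mul_smul]
    exact congrArg Subtype.val (hk p hp ⟨_, h q hq⟩)
  · rw [add_smul, hp, hq, add_zero]

lemma mkQ_exact {M : Type} [AddCommGroup M] [Module R M] (N : Submodule R M) :
    Function.Exact N.subtype N.mkQ := by
  intro m
  simp

variable [IsLocalRing R]

lemma exists_avoid (s : Set (Ideal R)) (hs : s.Finite) (hp : ∀ p ∈ s, p.IsPrime) :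
    ∃ y ∈ maximalIdeal R, ∀ p ∈ s, p ≠ maximalIdeal R → y ∉ p := by
  by_contra! hcon
  have h2 : (s \ {maximalIdeal R}).Finite := hs.subset Set.sdiff_subset
  have := (Ideal.subset_union_prime_finite h2 (f := id) ⊤ ⊤
    (fun p hps _ _ => hp p hps.1) (I := maximalIdeal R)).1 (by
      intro y hy
      obtain ⟨p, h1, h2, h3⟩ := hcon y hy
      simp only [Set.mem_iUnion]
      exact ⟨p, ⟨h1, h2⟩, h3⟩)
  obtain ⟨p, ⟨h1, h2⟩, h3⟩ := this
  exact h2 ((maximalIdeal.isMaximal R).eq_of_le (hp p h1).ne_top h3).symm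

lemma tor_lemma [IsNoetherianRing R] : ∀ (t : ℕ) {M : Type} [AddCommGroup M] [Module R M] [Module.Finite R M]
    (n : ℕ) (a : Ideal R), Dle a t →
    (∀ i ≤ t, ∀ r ∈ (maximalIdeal R) ^ n, ∀ c : H (maximalIdeal R) i M, r • c = 0) →
    ∀ u : M, (∀ r ∈ a, r • u = 0) → u ∈ Gam (maximalIdeal R) M := by
  intro t
  induction t with
  | zero =>
    intro M _ _ _ n a ha _ u hu
    obtain ⟨k, hk⟩ := ha.zero
    exact ⟨k, fun r hr => hu r (hk hr)⟩
  | succ t ih =>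
    intro M _ _ _ n a ha hH u hu
    set 𝔪 := maximalIdeal R with h𝔪
    let G := Gam 𝔪 M
    let M' := M ⧸ G
    have hT0 : ∀ v : M', v ∈ Gam 𝔪 M' → v = 0 := by
      rintro v ⟨k, hk⟩
      obtain ⟨w, rfl⟩ := G.mkQ_surjective v
      refine (Submodule.Quotient.mk_eq_zero _).2 (Gam_quot (n := k) (fun r hr => ?_))
      have := hk r hr
      rw [← map_smul] at this
      exact (Submodule.Quotient.mk_eq_zero _).1 this
    have hGinj := G.injective_subtype
    have hGex := mkQ_exact G
    have hGs := G.mkQ_surjective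
    have hH' : ∀ i ≤ t + 1, ∀ r ∈ 𝔪 ^ n, ∀ c : H 𝔪 i M', r • c = 0 := by
      intro i hi r hr c
      obtain ⟨b, rfl⟩ := exact_right hGinj hGex hGs c (H_tor_zero i isTor_Gam _)
      rw [← map_smul, hH i hi r hr b, map_zero]
    obtain ⟨y, hym, hy⟩ := exists_avoid (associatedPrimes R M' ∪ a.minimalPrimes)
      ((associatedPrimes.finite R M').union (Ideal.finite_minimalPrimes_of_isNoetherianRing R a))
      (by rintro p (hp | hp)
          · exact hp.isPrime
          · exact hp.1.1)
    have hreg : ∀ v : M', y • v = 0 → v = 0 := by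
      intro v hv
      by_contra hv0
      have : y ∈ {r : R | ∃ x : M', x ≠ 0 ∧ r • x = 0} := ⟨v, hv0, hv⟩
      rw [← biUnion_associatedPrimes_eq_zero_divisors] at this
      simp only [Set.mem_iUnion] at this
      obtain ⟨p, hp, hyp⟩ := this
      by_cases hpm : p = 𝔪
      · obtain ⟨hpp, w, hw⟩ := Submodule.isAssociatedPrime_iff.1 hp
        have hw0 : w = 0 := by
          apply hT0
          refine ⟨1, fun r hr => ?_⟩
          rw [pow_one, ← hpm, hw] at hr
          simpa [Submodule.mem_colon_singleton] using hr
        apply hpp.ne_top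
        rw [hw, hw0, Ideal.eq_top_iff_one]
        simp [Submodule.mem_colon_singleton]
      · exact hy p (Or.inl hp) hpm hyp
    have hregk : ∀ k (v : M'), y ^ k • v = 0 → v = 0 := by
      intro k
      induction k with
      | zero => intro v; simp
      | succ k ihk =>
        intro v hv
        rw [pow_succ, mul_smul] at hv
        exact hreg v (ihk _ hv)
    have key : ∀ k, ∀ s ∈ 𝔪 ^ (n + n), ∃ w : M', y ^ (k+1) • w = s • G.mkQ u := by
      intro k s hs
      let z := y ^ (k+1)
      let ι : M' →ₗ[R] M' := LinearMap.lsmul R M' z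
      have hι : Function.Injective ι := by
        rw [injective_iff_map_eq_zero]
        exact fun v hv => hregk (k+1) v hv
      let B := LinearMap.range ι
      have hex : Function.Exact ι B.mkQ := LinearMap.exact_map_mkQ_range ι
      have hπ := B.mkQ_surjective
      have hHB : ∀ i ≤ t, ∀ r ∈ 𝔪 ^ (n + n), ∀ c : H 𝔪 i (M' ⧸ B), r • c = 0 := by
        intro i hi r hr c
        rw [pow_add] at hr
        refine Submodule.mul_induction_on hr (fun p hp q hq => ?_) (fun p q hp hq => ?_)
        · obtain ⟨b, hb⟩ := exact_right hι hex hπ (q • c) (by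
            rw [map_smul]; exact hH' (i+1) (by omega) q hq _)
          rw [mul_smul, ← hb, ← map_smul, hH' i (by omega) p hp b, map_zero]
        · rw [add_smul, hp, hq, add_zero]
      have hD : Dle (a ⊔ Ideal.span {z}) t := by
        refine ha.succ (fun p hp hpm hz => hy p (Or.inr hp) hpm ?_)
        have := hp.1.1
        exact Ideal.IsPrime.mem_of_pow_mem this _ hz
      obtain ⟨e, he⟩ := ih (n + n) _ hD hHB (B.mkQ (G.mkQ u)) (by
        intro r hr
        obtain ⟨r1, hr1, r2, hr2, rfl⟩ := Submodule.mem_sup.1 hr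
        obtain ⟨r3, rfl⟩ := Ideal.mem_span_singleton'.1 hr2
        rw [add_smul, ← map_smul, ← map_smul, hu r1 hr1, map_zero, map_zero, zero_add, mul_smul,
          ← map_smul]
        have : B.mkQ (z • G.mkQ u) = 0 := (Submodule.Quotient.mk_eq_zero _).2 ⟨_, rfl⟩
        rw [this, smul_zero])
      have h0 := smul_eq_zero_of_H0 (hHB 0 (by omega) s hs) he
      rw [← map_smul] at h0
      exact (Submodule.Quotient.mk_eq_zero _).1 h0
    have hfin : G.mkQ u ∈ Gam 𝔪 M' := by
      refine ⟨n + n, fun s hs => ?_⟩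
      have hb := Ideal.iInf_pow_smul_eq_bot_of_isLocalRing (R := R) (M := M') (Ideal.span {y})
        (by rw [Ne, Ideal.span_singleton_eq_top]; exact (mem_maximalIdeal y).1 hym)
      have : s • G.mkQ u ∈ (⨅ i : ℕ, Ideal.span {y} ^ i • (⊤ : Submodule R M')) := by
        rw [Submodule.mem_iInf]
        intro k
        obtain ⟨w, hw⟩ := key k s hs
        rw [← hw, pow_succ', mul_smul, smul_comm]
        exact Submodule.smul_mem_smul (Ideal.pow_mem_pow (Ideal.mem_span_singleton_self y) k)
          Submodule.mem_top
      rw [hb] at this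
      exact this
    exact (Submodule.Quotient.mk_eq_zero _).1 (hT0 _ hfin)

end torlem

section main
variable {R : Type} [CommRing R] {I : Ideal R}
variable {A B C : Type} [AddCommGroup A] [Module R A] [AddCommGroup B] [Module R B] {i : ℕ}

lemma Hmap_sum {κ : Type} (s : Finset κ) (g : κ → A →ₗ[R] B) (c : H I i A) :
    Hmap I i (∑ k ∈ s, g k) c = ∑ k ∈ s, Hmap I i (g k) c := by
  classical
  induction s using Finset.induction_on with
  | empty => simp [Hmap_zero]
  | insert k s hk ih => rw [Finset.sum_insert hk, Finset.sum_insert hk, Hmap_add, ih]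

lemma H_surj [IsNoetherianRing R] {f : A →ₗ[R] B} (hf : Function.Surjective f)
    (hk : IsTor I (LinearMap.ker f)) (c : H I i B) : ∃ a, Hmap I i f a = c :=
  exact_right (LinearMap.ker f).injective_subtype (LinearMap.exact_subtype_ker_map f) hf c
    (H_tor_zero i hk _)

lemma H_inj [IsNoetherianRing R] {f : A →ₗ[R] B} (hf : Function.Surjective f)
    (hk : IsTor I (LinearMap.ker f)) (c : H I (i+1) A) (hc : Hmap I (i+1) f c = 0) : c = 0 := by
  obtain ⟨a, rfl⟩ := exact_mid (LinearMap.ker f).injective_subtype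
    (LinearMap.exact_subtype_ker_map f) hf c hc
  rw [H_tor_zero i hk a, map_zero]

theorem split [IsNoetherianRing R] {M : Type} [AddCommGroup M] [Module R M] {x : R} {κ : Type}
    [Fintype κ] (a b : κ → R) (hx : x = ∑ k, a k * b k)
    (hK : ∀ m : M, x • m = 0 → m ∈ Gam I M) (i : ℕ)
    (ha : ∀ k, ∀ c : H I i M, a k • c = 0) (hb : ∀ k, ∀ c : H I (i+1) M, b k • c = 0) :
    Nonempty (H I i (M ⧸ (Ideal.span {x} • (⊤ : Submodule R M))) ≃ₗ[R]
      H I i M × H I (i+1) M) := by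
  classical
  set N := Ideal.span {x} • (⊤ : Submodule R M) with hN
  have hmemN : ∀ m : M, x • m ∈ N := fun m =>
    Submodule.smul_mem_smul (Ideal.mem_span_singleton_self x) Submodule.mem_top
  have hxi : ∀ c : H I i M, x • c = 0 := by
    intro c
    rw [hx, Finset.sum_smul]
    exact Finset.sum_eq_zero (fun k _ => by rw [mul_smul, ha])
  let μ : M →ₗ[R] N := LinearMap.codRestrict N (LinearMap.lsmul R M x) hmemN
  have hμs : Function.Surjective μ := by
    rintro ⟨m, hm⟩
    rw [hN, Submodule.ideal_span_singleton_smul] at hm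
    obtain ⟨m', -, rfl⟩ := hm
    exact ⟨m', rfl⟩
  have tor : ∀ (L : Submodule R M), (∀ m ∈ L, x • m = 0) → IsTor I L := by
    rintro L hL ⟨m, hm⟩
    obtain ⟨n, hn⟩ := hK m (hL m hm)
    exact ⟨n, fun r hr => Subtype.ext (hn r hr)⟩
  have hμk : IsTor I (LinearMap.ker μ) := tor _ (fun m hm => congrArg Subtype.val hm)
  have hNi := N.injective_subtype
  have hNe := mkQ_exact N
  have hNs := N.mkQ_surjective
  have hπ : ∀ c : H I i M, Hmap I i N.mkQ c = 0 → c = 0 := by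
    intro c hc
    obtain ⟨c1, rfl⟩ := exact_mid hNi hNe hNs c hc
    obtain ⟨c2, rfl⟩ := H_surj hμs hμk c1
    rw [← Hmap_comp]
    have : N.subtype ∘ₗ μ = x • LinearMap.id := rfl
    rw [this, Hmap_smul, Hmap_id]
    exact hxi c2
  let β : M →ₗ[R] (κ → M) := ∑ k, b k • LinearMap.single R (fun _ => M) k
  let α : (κ → M) →ₗ[R] M := ∑ k, a k • LinearMap.proj k
  have hβ : ∀ m k, β m k = b k • m := by
    intro m k
    simp [β, Finset.sum_apply, Pi.single_apply]
  have hαβ : ∀ m, α (β m) = x • m := by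
    intro m
    simp only [α, LinearMap.sum_apply, LinearMap.smul_apply, LinearMap.proj_apply, hβ]
    rw [hx, Finset.sum_smul]
    exact Finset.sum_congr rfl (fun k _ => by rw [mul_smul])
  let β' := β.rangeRestrict
  have hβs : Function.Surjective β' := β.surjective_rangeRestrict
  have hβk : IsTor I (LinearMap.ker β') := tor _ (fun m hm => by
    have : β m = 0 := congrArg Subtype.val hm
    rw [← hαβ, this, map_zero])
  let P := LinearMap.range β
  have hPi := P.injective_subtype
  have hPe := mkQ_exact P
  have hPs := P.mkQ_surjective
  have hPN : ∀ p : P, α p.1 ∈ N := by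
    rintro ⟨_, m, rfl⟩
    rw [hαβ]
    exact hmemN m
  let αP : P →ₗ[R] N := LinearMap.codRestrict N (α ∘ₗ P.subtype) hPN
  let αQ : ((κ → M) ⧸ P) →ₗ[R] (M ⧸ N) := P.mapQ N α (fun p hp => hPN ⟨p, hp⟩)
  have hαμ : αP ∘ₗ β' = μ := by
    ext m
    exact hαβ m
  -- the connecting map upstairs is surjective
  have hs : ∀ v : H I (i+1) M, ∃ q, del I i hPi hPe hPs q = Hmap I (i+1) β' v := by
    intro v
    apply exact_left
    rw [← Hmap_comp]
    change Hmap I (i+1) β v = 0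
    rw [Hmap_sum]
    refine Finset.sum_eq_zero (fun k _ => ?_)
    rw [Hmap_smul, ← map_smul, hb, map_zero]
  have hk0 : ∀ q, del I i hPi hPe hPs q = 0 → Hmap I i αQ q = 0 := by
    intro q hq
    obtain ⟨p, rfl⟩ := exact_right hPi hPe hPs q hq
    rw [← Hmap_comp]
    have : αQ ∘ₗ P.mkQ = N.mkQ ∘ₗ α := rfl
    rw [this, Hmap_comp]
    have : Hmap I i α p = 0 := by
      rw [Hmap_sum]
      refine Finset.sum_eq_zero (fun k _ => ?_)
      rw [Hmap_smul, ha]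
    rw [this, map_zero]
  choose q hq using hs
  let σ : H I (i+1) M →ₗ[R] H I i (M ⧸ N) :=
    { toFun := fun v => Hmap I i αQ (q v)
      map_add' := fun v w => by
        rw [← map_add, ← sub_eq_zero, ← map_sub]
        apply hk0
        rw [map_sub, map_add, hq, hq, hq, map_add, sub_self]
      map_smul' := fun r v => by
        rw [RingHom.id_apply, ← map_smul, ← sub_eq_zero, ← map_sub]
        apply hk0
        rw [map_sub, map_smul, hq, hq, map_smul, sub_self] }
  have hσ : ∀ v, del I i hNi hNe hNs (σ v) = Hmap I (i+1) μ v := by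
    intro v
    change del I i hNi hNe hNs (Hmap I i αQ (q v)) = _
    rw [del_natural hPi hPe hPs hNi hNe hNs αP α αQ rfl rfl, hq, ← Hmap_comp, hαμ]
  let Φ : H I i M × H I (i+1) M →ₗ[R] H I i (M ⧸ N) := LinearMap.coprod (Hmap I i N.mkQ) σ
  have hΦ : ∀ u v, Φ (u, v) = Hmap I i N.mkQ u + σ v := fun u v => rfl
  refine ⟨(LinearEquiv.ofBijective Φ ⟨?_, ?_⟩).symm⟩
  · rw [injective_iff_map_eq_zero]
    rintro ⟨u, v⟩ h
    rw [hΦ] at h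
    have h1 := congrArg (del I i hNi hNe hNs) h
    rw [map_add, del_map, zero_add, hσ, map_zero] at h1
    have hv := H_inj hμs hμk v h1
    subst hv
    rw [map_zero, add_zero] at h
    rw [hπ u h]
    rfl
  · intro c
    obtain ⟨v, hv⟩ := H_surj hμs hμk (del I i hNi hNe hNs c)
    obtain ⟨u, hu⟩ := exact_right hNi hNe hNs (c - σ v) (by rw [map_sub, hσ, hv, sub_self])
    exact ⟨(u, v), by rw [hΦ, hu, sub_add_cancel]⟩

end main

lemma mem_mul_sum {R : Type} [CommRing R] {J K : Ideal R} {x : R} (h : x ∈ J * K) :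
    ∃ (n : ℕ) (a b : Fin n → R), (∀ k, a k ∈ J) ∧ (∀ k, b k ∈ K) ∧ x = ∑ k, a k * b k := by
  refine Submodule.mul_induction_on h (fun p hp q hq => ?_) ?_
  · exact ⟨1, fun _ => p, fun _ => q, fun _ => hp, fun _ => hq, by simp⟩
  · rintro _ _ ⟨n, a, b, ha, hb, rfl⟩ ⟨m, a', b', ha', hb', rfl⟩
    refine ⟨n + m, Fin.append a a', Fin.append b b', ?_, ?_, ?_⟩
    · intro k
      induction k using Fin.addCases <;> simp [ha, ha']
    · intro k
      induction k using Fin.addCases <;> simp [hb, hb']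
    · simp [Fin.sum_univ_add]

open scoped Pointwise in
lemma Dle_par {R : Type} [CommRing R] {M : Type} [AddCommGroup M] [Module R M]
    [Module.Finite R M] {x : R} {t : ℕ} (h : Dle (Module.annihilator R
      (M ⧸ (Ideal.span {x} • (⊤ : Submodule R M)))) t) :
    Dle (Module.annihilator R M ⊔ Ideal.span {x}) t := by
  refine h.mono ?_
  rw [Submodule.ideal_span_singleton_smul]
  have h1 : Module.support R (M ⧸ (x • (⊤ : Submodule R M))) =
    Module.support R M ∩ PrimeSpectrum.zeroLocus {x} := Module.support_quotSMulTop x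
  rw [Module.support_eq_zeroLocus, Module.support_eq_zeroLocus] at h1
  rw [h1]
  intro p hp
  have hp' : Module.annihilator R M ⊔ Ideal.span {x} ≤ p.asIdeal := hp
  refine ⟨(le_sup_left (a := Module.annihilator R M)).trans hp', ?_⟩
  rw [PrimeSpectrum.mem_zeroLocus, Set.singleton_subset_iff]
  exact hp' (Ideal.mem_sup_right (Ideal.mem_span_singleton_self x))

end LCSplit
/-- **Corollary 4.1, first part.** Let `M` be a generalized Cohen-Macaulay module of
dimension `d > 0` over a Noetherian local ring `(R, 𝔪)` and let `n₀` be the least positive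
integer with `𝔪^{n₀}·H^i_𝔪(M) = 0` for all `i < d`. Then for every parameter element
`x ∈ 𝔪^{2n₀}` of `M` and all `i < d - 1`,
`H^i_𝔪(M/xM) ≅ H^i_𝔪(M) ⊕ H^{i+1}_𝔪(M)`. -/
theorem localCohomology_splitting_of_generalizedCM
    {R : Type} [CommRing R] [IsNoetherianRing R] [IsLocalRing R]
    (M : Type) [AddCommGroup M] [Module R M] [Module.Finite R M]
    (d : ℕ) (hd : 0 < d)
    (hdim : ringKrullDim (R ⧸ Module.annihilator R M) = (d : WithBot (WithTop ℕ)))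
    (n₀ : ℕ)
    (hn₀ : IsLeast {k : ℕ | 0 < k ∧ ∀ i < d,
      (maximalIdeal R) ^ k ≤ Module.annihilator R
        ((localCohomology (maximalIdeal R) i).obj (ModuleCat.of R M))} n₀)
    (x : R) (hx : x ∈ (maximalIdeal R) ^ (2 * n₀))
    (hpar : ringKrullDim (R ⧸ Module.annihilator R
      (M ⧸ (Ideal.span {x} • (⊤ : Submodule R M)))) = ((d - 1 : ℕ) : WithBot (WithTop ℕ))) :
    ∀ i, i + 1 < d →
      Nonempty (((localCohomology (maximalIdeal R) i).obj
          (ModuleCat.of R (M ⧸ (Ideal.span {x} • (⊤ : Submodule R M))))) ≃ₗ[R]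
        ((localCohomology (maximalIdeal R) i).obj (ModuleCat.of R M)) ×
        ((localCohomology (maximalIdeal R) (i + 1)).obj (ModuleCat.of R M))) := by
  intro i hi
  have hkill : ∀ j < d, ∀ r ∈ (maximalIdeal R) ^ n₀, ∀ c : LCSplit.H (maximalIdeal R) j M,
      r • c = 0 := fun j hj r hr c => Module.mem_annihilator.1 (hn₀.1.2 j hj hr) c
  have hD := LCSplit.Dle_par (LCSplit.Dle.of_dim hpar.le)
  have hK : ∀ m : M, x • m = 0 → m ∈ LCSplit.Gam (maximalIdeal R) M := by
    intro m hm
    refine LCSplit.tor_lemma (d - 1) n₀ _ hD (fun j hj => hkill j (by omega)) m ?_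
    intro r hr
    obtain ⟨r1, hr1, r2, hr2, rfl⟩ := Submodule.mem_sup.1 hr
    obtain ⟨r3, rfl⟩ := Ideal.mem_span_singleton'.1 hr2
    rw [add_smul, Module.mem_annihilator.1 hr1, mul_smul, hm, smul_zero, add_zero]
  rw [two_mul, pow_add] at hx
  obtain ⟨n, a, b, ha, hb, hxs⟩ := LCSplit.mem_mul_sum hx
  exact LCSplit.split a b hxs hK i (fun k => hkill i (by omega) _ (ha k))
    (fun k => hkill (i+1) hi _ (hb k))
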